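/- arXiv:1706.09144 — 9 statements merged into one kernel-verified Lean document; each statement's English description precedes it below -/
import Mathlib

section
/- Let x, y, z : ℝ → ℝ be differentiable functions on [0,T) (0 < T ≤ ∞) satisfying the system (S) for all t ∈ [0,T), with x(0) > 0, y(0) > 0, z(0) > 0. Then x(t) > 0, y(t) > 0 and z(t) > 0 for all t ∈ [0,T). -/
/-- A solution of `f' = f * g` with `g` continuous that starts positive stays positive. -/
lemma pos_of_linear (f g : ℝ → ℝ) (τ : ℝ) (hτ : 0 ≤ τ) (hg : ContinuousOn g (Set.Icc 0 τ))
    (hf : ∀ t ∈ Set.Icc 0 τ, HasDerivAt f (f t * g t) t) (h0 : 0 < f 0) : 0 < f τ := by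
  let G : ℝ → ℝ := Set.IccExtend hτ ((Set.Icc 0 τ).domRestrict g)
  have hG : Continuous G := (continuousOn_iff_continuous_domRestrict.mp hg).Icc_extend'
  have hGg : ∀ t ∈ Set.Icc 0 τ, G t = g t := fun t ht => by
    simp only [G]
    rw [Set.IccExtend_of_mem hτ _ ht]
    rfl
  let H : ℝ → ℝ := fun t => ∫ s in (0:ℝ)..t, G s
  have hH : ∀ t, HasDerivAt H (G t) t := fun t => hG.integral_hasStrictDerivAt 0 t |>.hasDerivAt
  have hd : ∀ t ∈ Set.Icc 0 τ, HasDerivAt (fun t => f t * Real.exp (-H t)) 0 t := by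
    intro t ht
    have h := (hf t ht).mul ((hH t).neg.exp)
    rw [hGg t ht] at h
    refine HasDerivAt.congr_deriv h ?_
    show f t * g t * Real.exp (-H t) + f t * (Real.exp (-H t) * -g t) = 0
    ring
  have hc := constant_of_has_deriv_right_zero (f := fun t => f t * Real.exp (-H t)) (a := 0) (b := τ)
    (fun t ht => (hd t ht).continuousAt.continuousWithinAt)
    (fun t ht => (hd t ⟨ht.1, ht.2.le⟩).hasDerivWithinAt) τ ⟨hτ, le_rfl⟩
  have h1 : 0 < f 0 * Real.exp (-H 0) := by positivity
  rw [← hc] at h1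
  exact pos_of_mul_pos_left h1 (Real.exp_pos _).le

/-- Positivity of solutions of the eco-epidemic system (S) on `[0, T)`. -/
theorem positivity_of_solutions
    (a1 a2 a3 b1 c1 c2 c3 k1 k2 θ p : ℝ)
    (ha1 : 0 < a1) (ha2 : 0 < a2) (ha3 : 0 < a3) (hb1 : 0 < b1)
    (hc1 : 0 < c1) (hc2 : 0 < c2) (hc3 : 0 < c3)
    (hk1 : 0 < k1) (hk2 : 0 < k2) (hθ : 0 < θ) (hp : 0 < p) (hp1 : p ≤ 1)
    (T : EReal) (hT : 0 < T)
    (x y z : ℝ → ℝ)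
    (hx : ∀ t : ℝ, 0 ≤ t → (t : EReal) < T →
      HasDerivAt x (a1 * x t - b1 * (x t) ^ 2 - c1 * (x t) ^ 2 * y t / (k1 + (x t) ^ 2)
        - p * c1 * (x t) ^ 2 * z t / (k1 + (x t) ^ 2)) t)
    (hy : ∀ t : ℝ, 0 ≤ t → (t : EReal) < T →
      HasDerivAt y (a2 * y t - c2 * y t * (y t + z t) / (k2 + x t) - θ * y t * z t) t)
    (hz : ∀ t : ℝ, 0 ≤ t → (t : EReal) < T →
      HasDerivAt z (θ * y t * z t + a3 * z t - c3 * z t * (y t + z t) / (k2 + x t)) t)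
    (hx0 : 0 < x 0) (hy0 : 0 < y 0) (hz0 : 0 < z 0) :
    ∀ t : ℝ, 0 ≤ t → (t : EReal) < T → 0 < x t ∧ 0 < y t ∧ 0 < z t := by
  intro τ hτ hτT
  have hlt : ∀ t : ℝ, t ≤ τ → (t : EReal) < T := fun t ht =>
    lt_of_le_of_lt (EReal.coe_le_coe_iff.mpr ht) hτT
  have cx : ∀ s : ℝ, s ≤ τ → ContinuousOn x (Set.Icc 0 s) := fun s hs t ht =>
    (hx t ht.1 (hlt t (ht.2.trans hs))).continuousAt.continuousWithinAt
  have cy : ∀ s : ℝ, s ≤ τ → ContinuousOn y (Set.Icc 0 s) := fun s hs t ht =>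
    (hy t ht.1 (hlt t (ht.2.trans hs))).continuousAt.continuousWithinAt
  have cz : ∀ s : ℝ, s ≤ τ → ContinuousOn z (Set.Icc 0 s) := fun s hs t ht =>
    (hz t ht.1 (hlt t (ht.2.trans hs))).continuousAt.continuousWithinAt
  have hxpos : ∀ s ∈ Set.Icc 0 τ, 0 < x s := by
    intro s hs
    have cx := cx s hs.2
    have cy := cy s hs.2
    have cz := cz s hs.2
    have hne : ∀ t ∈ Set.Icc 0 s, k1 + (x t) ^ 2 ≠ 0 := fun t _ => by positivity
    refine pos_of_linear x (fun t => a1 - b1 * x t - c1 * x t * y t / (k1 + (x t) ^ 2)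
      - p * c1 * x t * z t / (k1 + (x t) ^ 2)) s hs.1 ?_ ?_ hx0
    · fun_prop (disch := assumption)
    · intro t ht
      convert hx t ht.1 (hlt t (ht.2.trans hs.2)) using 1
      ring
  have cx := cx τ le_rfl
  have cy := cy τ le_rfl
  have cz := cz τ le_rfl
  have hne : ∀ t ∈ Set.Icc 0 τ, k2 + x t ≠ 0 := fun t ht => by
    have := hxpos t ht
    positivity
  refine ⟨hxpos τ ⟨hτ, le_rfl⟩, ?_, ?_⟩
  · refine pos_of_linear y (fun t => a2 - c2 * (y t + z t) / (k2 + x t) - θ * z t) τ hτ ?_ ?_ hy0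
    · fun_prop (disch := assumption)
    · intro t ht
      convert hy t ht.1 (hlt t ht.2) using 1
      ring
  · refine pos_of_linear z (fun t => θ * y t + a3 - c3 * (y t + z t) / (k2 + x t)) τ hτ ?_ ?_ hz0
    · fun_prop (disch := assumption)
    · intro t ht
      convert hz t ht.1 (hlt t ht.2) using 1
      ring
end

section
/- Let x, y, z : ℝ → ℝ be differentiable on [0,T) with x(t) ≥ 0, y(t) ≥ 0, z(t) ≥ 0, satisfying the system (S), and let ω(t) = x(t) + y(t) + z(t). Then for every μ > 0 and every t ∈ [0,T), ω'(t) + μ·ω(t) ≤ (a1+μ)²/(4·b1) + (a2+μ)·y(t) + (a3+μ)·z(t). -/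
/-- The differential inequality satisfied by `ω = x + y + z` along solutions of (S). -/
theorem omega_differential_inequality
    (a1 a2 a3 b1 c1 c2 c3 k1 k2 θ p : ℝ)
    (ha1 : 0 < a1) (ha2 : 0 < a2) (ha3 : 0 < a3) (hb1 : 0 < b1)
    (hc1 : 0 < c1) (hc2 : 0 < c2) (hc3 : 0 < c3)
    (hk1 : 0 < k1) (hk2 : 0 < k2) (hθ : 0 < θ) (hp : 0 < p) (hp1 : p ≤ 1)
    (T : EReal) (hT : 0 < T)
    (x y z : ℝ → ℝ)
    (hxnn : ∀ t : ℝ, 0 ≤ t → (t : EReal) < T → 0 ≤ x t)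
    (hynn : ∀ t : ℝ, 0 ≤ t → (t : EReal) < T → 0 ≤ y t)
    (hznn : ∀ t : ℝ, 0 ≤ t → (t : EReal) < T → 0 ≤ z t)
    (hx : ∀ t : ℝ, 0 ≤ t → (t : EReal) < T →
      HasDerivAt x (a1 * x t - b1 * (x t) ^ 2 - c1 * (x t) ^ 2 * y t / (k1 + (x t) ^ 2)
        - p * c1 * (x t) ^ 2 * z t / (k1 + (x t) ^ 2)) t)
    (hy : ∀ t : ℝ, 0 ≤ t → (t : EReal) < T →
      HasDerivAt y (a2 * y t - c2 * y t * (y t + z t) / (k2 + x t) - θ * y t * z t) t)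
    (hz : ∀ t : ℝ, 0 ≤ t → (t : EReal) < T →
      HasDerivAt z (θ * y t * z t + a3 * z t - c3 * z t * (y t + z t) / (k2 + x t)) t) :
    ∀ μ : ℝ, 0 < μ → ∀ t : ℝ, 0 ≤ t → (t : EReal) < T →
      deriv (fun s => x s + y s + z s) t + μ * (x t + y t + z t)
        ≤ (a1 + μ) ^ 2 / (4 * b1) + (a2 + μ) * y t + (a3 + μ) * z t := by
  intro μ hμ t ht htT
  have X := hxnn t ht htT
  have Y := hynn t ht htT
  have Z := hznn t ht htT
  have hd : HasDerivAt (fun s => x s + y s + z s) _ t :=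
    ((hx t ht htT).add (hy t ht htT)).add (hz t ht htT)
  rw [hd.deriv]
  have h1 : 0 ≤ c1 * (x t) ^ 2 * y t / (k1 + (x t) ^ 2) := by positivity
  have h2 : 0 ≤ p * c1 * (x t) ^ 2 * z t / (k1 + (x t) ^ 2) := by positivity
  have h3 : 0 ≤ c2 * y t * (y t + z t) / (k2 + x t) := by positivity
  have h4 : 0 ≤ c3 * z t * (y t + z t) / (k2 + x t) := by positivity
  have h5 : (a1 + μ) * x t - b1 * (x t) ^ 2 ≤ (a1 + μ) ^ 2 / (4 * b1) := by
    rw [le_div_iff₀ (by positivity)]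
    nlinarith [sq_nonneg (a1 + μ - 2 * b1 * x t)]
  linarith
end

section
/- Suppose (x,y,z) with x > 0, y > 0, z > 0 is an equilibrium of system (S), i.e. g1(x,y,z) = g2(x,y,z) = g3(x,y,z) = 0, and suppose θ·(x + k2) + c2 − c3 ≠ 0. Then y = (−a3·θ·x − a3·k2·θ + a2·c3 − a3·c2)/(θ·(θ·x + k2·θ + c2 − c3)), z = −(−a2·θ·x − a2·k2·θ + a2·c3 − a3·c2)/(θ·(θ·x + k2·θ + c2 − c3)), and x is a root of the quartic P(X) = A4·X⁴ + A3·X³ + A2·X² + A1·X + A0 with A4 = b1·θ², A3 = b1·k2·θ² − a1·θ² + b1·c2·θ − b1·c3·θ, A2 = −a1·k2·θ² + a2·c1·θ·p + b1·k1·θ² − a1·c2·θ + a1·c3·θ − a3·c1·θ, A1 = a2·c1·k2·θ·p + b1·k1·k2·θ² − a1·k1·θ² − a2·c1·c3·p + a3·c1·c2·p − a3·c1·k2·θ + b1·c2·k1·θ − b1·c3·k1·θ + a2·c1·c3 − a3·c1·c2, A0 = −a1·k1·k2·θ² − a1·c2·k1·θ + a1·c3·k1·θ. -/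
/-- Coordinates of a positive (coexistence) equilibrium of system (S). -/
theorem coexistence_equilibrium_coordinates
    (a1 a2 a3 b1 c1 c2 c3 k1 k2 θ p : ℝ)
    (ha1 : 0 < a1) (ha2 : 0 < a2) (ha3 : 0 < a3) (hb1 : 0 < b1)
    (hc1 : 0 < c1) (hc2 : 0 < c2) (hc3 : 0 < c3)
    (hk1 : 0 < k1) (hk2 : 0 < k2) (hθ : 0 < θ) (hp : 0 < p) (hp1 : p ≤ 1)
    (x y z : ℝ) (hx : 0 < x) (hy : 0 < y) (hz : 0 < z)
    (h1 : a1 - b1 * x - c1 * x * y / (x ^ 2 + k1) - p * c1 * x * z / (x ^ 2 + k1) = 0)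
    (h2 : a2 - c2 * (y + z) / (x + k2) - θ * z = 0)
    (h3 : a3 - c3 * (y + z) / (x + k2) + θ * y = 0)
    (hden : θ * (x + k2) + c2 - c3 ≠ 0) :
    y = (-a3 * θ * x - a3 * k2 * θ + a2 * c3 - a3 * c2) / (θ * (θ * x + k2 * θ + c2 - c3)) ∧
    z = -((-a2 * θ * x - a2 * k2 * θ + a2 * c3 - a3 * c2) / (θ * (θ * x + k2 * θ + c2 - c3))) ∧
    (b1 * θ ^ 2) * x ^ 4
      + (b1 * k2 * θ ^ 2 - a1 * θ ^ 2 + b1 * c2 * θ - b1 * c3 * θ) * x ^ 3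
      + (-a1 * k2 * θ ^ 2 + a2 * c1 * θ * p + b1 * k1 * θ ^ 2 - a1 * c2 * θ + a1 * c3 * θ
          - a3 * c1 * θ) * x ^ 2
      + (a2 * c1 * k2 * θ * p + b1 * k1 * k2 * θ ^ 2 - a1 * k1 * θ ^ 2 - a2 * c1 * c3 * p
          + a3 * c1 * c2 * p - a3 * c1 * k2 * θ + b1 * c2 * k1 * θ - b1 * c3 * k1 * θ
          + a2 * c1 * c3 - a3 * c1 * c2) * x
      + (-a1 * k1 * k2 * θ ^ 2 - a1 * c2 * k1 * θ + a1 * c3 * k1 * θ) = 0 := by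
  have hu : x + k2 ≠ 0 := by positivity
  have hv : x ^ 2 + k1 ≠ 0 := by positivity
  have hD : θ * x + k2 * θ + c2 - c3 ≠ 0 := by
    intro h
    apply hden
    linear_combination h
  have hT : θ * (θ * x + k2 * θ + c2 - c3) ≠ 0 := mul_ne_zero hθ.ne' hD
  have e1 : (a1 - b1 * x) * (x ^ 2 + k1) - c1 * x * y - p * c1 * x * z = 0 := by
    field_simp at h1
    linear_combination h1
  have e2 : a2 * (x + k2) - c2 * (y + z) - θ * z * (x + k2) = 0 := by
    field_simp at h2
    linear_combination h2
  have e3 : a3 * (x + k2) - c3 * (y + z) + θ * y * (x + k2) = 0 := by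
    field_simp at h3
    linear_combination h3
  have ey : y * (θ * (θ * x + k2 * θ + c2 - c3))
      = -a3 * θ * x - a3 * k2 * θ + a2 * c3 - a3 * c2 := by
    apply mul_left_cancel₀ hu
    linear_combination (-c3) * e2 + (c2 + θ * (x + k2)) * e3
  have ez : z * (θ * (θ * x + k2 * θ + c2 - c3))
      = -(-a2 * θ * x - a2 * k2 * θ + a2 * c3 - a3 * c2) := by
    apply mul_left_cancel₀ hu
    linear_combination (-(θ * (x + k2) - c3)) * e2 - c2 * e3
  refine ⟨?_, ?_, ?_⟩
  · rw [eq_div_iff hT]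
    exact ey
  · rw [← neg_div, eq_div_iff hT]
    exact ez
  · linear_combination (-(θ * (θ * x + k2 * θ + c2 - c3))) * e1 - c1 * x * ey - p * c1 * x * ez
end

section
/- (Routh–Hurwitz criterion for cubics.) Let A1, A2, A3 be real numbers with A1 > 0, A3 > 0 and A1·A2 − A3 > 0. Then every complex root λ of the polynomial λ³ + A1·λ² + A2·λ + A3 satisfies Re(λ) < 0. -/
/-- Routh–Hurwitz criterion for a monic real cubic: if `A1 > 0`, `A3 > 0` and
`A1·A2 − A3 > 0`, then every complex root of `λ³ + A1·λ² + A2·λ + A3` has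
negative real part. -/
theorem routh_hurwitz_cubic
    (A1 A2 A3 : ℝ) (h1 : 0 < A1) (h3 : 0 < A3) (h12 : 0 < A1 * A2 - A3) :
    ∀ lam : ℂ, lam ^ 3 + (A1 : ℂ) * lam ^ 2 + (A2 : ℂ) * lam + (A3 : ℂ) = 0 →
      lam.re < 0 := by
  intro lam h
  obtain ⟨x, y⟩ := lam
  have hre := congrArg Complex.re h
  have him := congrArg Complex.im h
  simp [pow_succ] at hre him
  show x < 0
  by_contra hx
  have hx : 0 ≤ x := not_lt.mp hx
  have hA2 : 0 < A2 := by
    have : 0 < A1 * A2 := by linarith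
    exact (mul_pos_iff_of_pos_left h1).mp this
  have p1 : 0 ≤ x ^ 3 := by positivity
  have p2 : 0 ≤ A1 * x ^ 2 := by positivity
  have p3 : 0 ≤ A2 * x := by positivity
  have p4 : 0 ≤ A1 ^ 2 * x := by positivity
  have him' : y * (3 * x ^ 2 - y ^ 2 + 2 * A1 * x + A2) = 0 := by linarith
  rcases mul_eq_zero.mp him' with hy | hy
  · subst hy
    linarith
  · have hy2 : y ^ 2 = 3 * x ^ 2 + 2 * A1 * x + A2 := by linarith
    have key : x ^ 3 + A1 * x ^ 2 + A2 * x + A3 - (3 * x + A1) * y ^ 2 = 0 := by linarith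
    rw [hy2] at key
    linarith
end

section
/- Let (x5, y5, 0) with x5 > 0, y5 > 0 be an equilibrium of system (S) (so y5 = a2·(x5+k2)/c2). Assume (i) b1·x5 + c1·x5·y5/(x5²+k1) > 2·c1·x5³·y5/(x5²+k1)², and (ii) c3·y5/(x5+k2) > θ·y5 + a3. Then every complex eigenvalue of the Jacobian matrix J(x5, y5, 0) of the vector field F has negative real part. -/
/-- The eco-epidemic vector field `F` on `ℝ³`. -/
noncomputable def ecoField (a1 a2 a3 b1 c1 c2 c3 k1 k2 θ p : ℝ)
    (v : Fin 3 → ℝ) : Fin 3 → ℝ :=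
  ![a1 * v 0 - b1 * (v 0) ^ 2 - c1 * (v 0) ^ 2 * v 1 / (k1 + (v 0) ^ 2)
      - p * c1 * (v 0) ^ 2 * v 2 / (k1 + (v 0) ^ 2),
    a2 * v 1 - c2 * v 1 * (v 1 + v 2) / (k2 + v 0) - θ * v 1 * v 2,
    θ * v 1 * v 2 + a3 * v 2 - c3 * v 2 * (v 1 + v 2) / (k2 + v 0)]

/-- The Jacobian matrix of the eco-epidemic vector field at a point. -/
noncomputable def ecoJacobian (a1 a2 a3 b1 c1 c2 c3 k1 k2 θ p : ℝ)
    (pt : Fin 3 → ℝ) : Matrix (Fin 3) (Fin 3) ℝ :=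
  fun i j =>
    fderiv ℝ (fun v => ecoField a1 a2 a3 b1 c1 c2 c3 k1 k2 θ p v i) pt (Pi.single j 1)

theorem fderiv_of_line {f : (Fin 3 → ℝ) → ℝ} {pt w : Fin 3 → ℝ} {d : ℝ}
    (hf : DifferentiableAt ℝ f pt)
    (h : HasDerivAt (fun t : ℝ => f (fun i => pt i + t * w i)) d 0) :
    fderiv ℝ f pt w = d := by
  have h1 : HasLineDerivAt ℝ f d pt w := h
  rw [← hf.lineDeriv_eq_fderiv]
  exact h1.lineDeriv

theorem two_dim_neg {A B C D : ℝ} (hA : A < 0) (hB : B < 0) (hC : 0 < C) (hD : D < 0)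
    {μ u w : ℂ} (h : u ≠ 0 ∨ w ≠ 0)
    (e1 : (A : ℂ) * u + B * w = μ * u) (e2 : (C : ℂ) * u + D * w = μ * w) : μ.re < 0 := by
  have r1 := congrArg Complex.re e1
  have i1 := congrArg Complex.im e1
  have r2 := congrArg Complex.re e2
  have i2 := congrArg Complex.im e2
  simp at r1 i1 r2 i2
  have key : μ.re * (C * (u.re ^ 2 + u.im ^ 2) + (-B) * (w.re ^ 2 + w.im ^ 2))
      = C * A * (u.re ^ 2 + u.im ^ 2) + (-B) * D * (w.re ^ 2 + w.im ^ 2) := by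
    linear_combination (-C * u.re) * r1 + (-C * u.im) * i1 + (B * w.re) * r2 + (B * w.im) * i2
  have hCA : C * A < 0 := mul_neg_of_pos_of_neg hC hA
  have hBD : (-B) * D < 0 := mul_neg_of_pos_of_neg (by linarith) hD
  have pos : ∀ z : ℂ, z ≠ 0 → 0 < z.re ^ 2 + z.im ^ 2 := by
    intro z hz
    have := Complex.normSq_pos.2 hz
    rw [Complex.normSq_apply] at this
    nlinarith
  have nn : ∀ z : ℂ, 0 ≤ z.re ^ 2 + z.im ^ 2 := fun z => by positivity
  by_contra hμ
  push Not at hμ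
  have h1 : 0 ≤ μ.re * (C * (u.re ^ 2 + u.im ^ 2) + (-B) * (w.re ^ 2 + w.im ^ 2)) :=
    mul_nonneg hμ (add_nonneg (mul_nonneg hC.le (nn u)) (mul_nonneg (by linarith) (nn w)))
  rw [key] at h1
  rcases h with h | h
  · have := mul_neg_of_neg_of_pos hCA (pos u h)
    have := mul_nonpos_of_nonpos_of_nonneg hBD.le (nn w)
    linarith
  · have := mul_neg_of_neg_of_pos hBD (pos w h)
    have := mul_nonpos_of_nonpos_of_nonneg hCA.le (nn u)
    linarith

theorem row0 (a1 a2 a3 b1 c1 c2 c3 k1 k2 θ p x y : ℝ) (hk : k1 + x ^ 2 ≠ 0) (w : Fin 3 → ℝ) :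
    fderiv ℝ (fun v => ecoField a1 a2 a3 b1 c1 c2 c3 k1 k2 θ p v 0) ![x, y, 0] w
      = (a1 - 2 * b1 * x - 2 * c1 * x * y / (k1 + x ^ 2)
          + 2 * c1 * x ^ 3 * y / (k1 + x ^ 2) ^ 2) * w 0
        - c1 * x ^ 2 / (k1 + x ^ 2) * w 1 - p * c1 * x ^ 2 / (k1 + x ^ 2) * w 2 := by
  apply fderiv_of_line
  · simp only [ecoField, Matrix.cons_val]
    fun_prop (disch := simpa using hk)
  · simp only [ecoField, Matrix.cons_val]
    have X : HasDerivAt (fun t : ℝ => x + t * w 0) (w 0) 0 := by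
      simpa using ((hasDerivAt_id (0:ℝ)).mul_const (w 0)).const_add x
    have Y : HasDerivAt (fun t : ℝ => y + t * w 1) (w 1) 0 := by
      simpa using ((hasDerivAt_id (0:ℝ)).mul_const (w 1)).const_add y
    have Z : HasDerivAt (fun t : ℝ => 0 + t * w 2) (w 2) 0 := by
      simpa using ((hasDerivAt_id (0:ℝ)).mul_const (w 2)).const_add 0
    have D := (X.fun_pow 2).const_add k1
    have hD : k1 + (x + 0 * w 0) ^ 2 ≠ 0 := by simpa using hk
    have H := (((X.const_mul a1).fun_sub ((X.fun_pow 2).const_mul b1)).fun_sub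
      ((((X.fun_pow 2).const_mul c1).fun_mul Y).fun_div D hD)).fun_sub
      ((((X.fun_pow 2).const_mul (p * c1)).fun_mul Z).fun_div D hD)
    refine H.congr_deriv ?_
    simp
    field_simp
    ring

theorem row1 (a1 a2 a3 b1 c1 c2 c3 k1 k2 θ p x y : ℝ) (hk : k2 + x ≠ 0) (w : Fin 3 → ℝ) :
    fderiv ℝ (fun v => ecoField a1 a2 a3 b1 c1 c2 c3 k1 k2 θ p v 1) ![x, y, 0] w
      = c2 * y ^ 2 / (k2 + x) ^ 2 * w 0 + (a2 - 2 * c2 * y / (k2 + x)) * w 1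
        - (c2 * y / (k2 + x) + θ * y) * w 2 := by
  apply fderiv_of_line
  · simp only [ecoField, Matrix.cons_val]
    fun_prop (disch := simpa using hk)
  · simp only [ecoField, Matrix.cons_val]
    have X : HasDerivAt (fun t : ℝ => x + t * w 0) (w 0) 0 := by
      simpa using ((hasDerivAt_id (0:ℝ)).mul_const (w 0)).const_add x
    have Y : HasDerivAt (fun t : ℝ => y + t * w 1) (w 1) 0 := by
      simpa using ((hasDerivAt_id (0:ℝ)).mul_const (w 1)).const_add y
    have Z : HasDerivAt (fun t : ℝ => 0 + t * w 2) (w 2) 0 := by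
      simpa using ((hasDerivAt_id (0:ℝ)).mul_const (w 2)).const_add 0
    have D := X.const_add k2
    have hD : k2 + (x + 0 * w 0) ≠ 0 := by simpa using hk
    have H := ((Y.const_mul a2).fun_sub
      (((Y.const_mul c2).fun_mul (Y.fun_add Z)).fun_div D hD)).fun_sub
      ((Y.const_mul θ).fun_mul Z)
    refine H.congr_deriv ?_
    simp
    field_simp
    ring

theorem row2 (a1 a2 a3 b1 c1 c2 c3 k1 k2 θ p x y : ℝ) (hk : k2 + x ≠ 0) (w : Fin 3 → ℝ) :
    fderiv ℝ (fun v => ecoField a1 a2 a3 b1 c1 c2 c3 k1 k2 θ p v 2) ![x, y, 0] w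
      = (θ * y + a3 - c3 * y / (k2 + x)) * w 2 := by
  apply fderiv_of_line
  · simp only [ecoField, Matrix.cons_val]
    fun_prop (disch := simpa using hk)
  · simp only [ecoField, Matrix.cons_val]
    have X : HasDerivAt (fun t : ℝ => x + t * w 0) (w 0) 0 := by
      simpa using ((hasDerivAt_id (0:ℝ)).mul_const (w 0)).const_add x
    have Y : HasDerivAt (fun t : ℝ => y + t * w 1) (w 1) 0 := by
      simpa using ((hasDerivAt_id (0:ℝ)).mul_const (w 1)).const_add y
    have Z : HasDerivAt (fun t : ℝ => 0 + t * w 2) (w 2) 0 := by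
      simpa using ((hasDerivAt_id (0:ℝ)).mul_const (w 2)).const_add 0
    have D := X.const_add k2
    have hD : k2 + (x + 0 * w 0) ≠ 0 := by simpa using hk
    have H := (((Y.const_mul θ).fun_mul Z).fun_add (Z.const_mul a3)).fun_sub
      (((Z.const_mul c3).fun_mul (Y.fun_add Z)).fun_div D hD)
    refine H.congr_deriv ?_
    simp
    field_simp

/-- Local asymptotic stability of the planar equilibrium `E5 = (x5, y5, 0)`:
under conditions (i) and (ii) every complex eigenvalue of the Jacobian at `E5`
has negative real part. -/
theorem E5_eigenvalues_negative_real_part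
    (a1 a2 a3 b1 c1 c2 c3 k1 k2 θ p : ℝ)
    (ha1 : 0 < a1) (ha2 : 0 < a2) (ha3 : 0 < a3) (hb1 : 0 < b1)
    (hc1 : 0 < c1) (hc2 : 0 < c2) (hc3 : 0 < c3)
    (hk1 : 0 < k1) (hk2 : 0 < k2) (hθ : 0 < θ) (hp : 0 < p) (hp1 : p ≤ 1)
    (x5 y5 : ℝ) (hx5 : 0 < x5) (hy5 : 0 < y5)
    (heq : ecoField a1 a2 a3 b1 c1 c2 c3 k1 k2 θ p ![x5, y5, 0] = 0)
    (hi : b1 * x5 + c1 * x5 * y5 / (x5 ^ 2 + k1)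
        > 2 * c1 * x5 ^ 3 * y5 / (x5 ^ 2 + k1) ^ 2)
    (hii : c3 * y5 / (x5 + k2) > θ * y5 + a3) :
    ∀ μ : ℂ,
      (∃ v : Fin 3 → ℂ, v ≠ 0 ∧
        ((ecoJacobian a1 a2 a3 b1 c1 c2 c3 k1 k2 θ p ![x5, y5, 0]).map
            (fun r : ℝ => (r : ℂ))).mulVec v = μ • v) →
      μ.re < 0 := by
  rintro μ ⟨v, hv, hev⟩
  have hD1 : 0 < k1 + x5 ^ 2 := by positivity
  have hD2 : 0 < k2 + x5 := by positivity
  have q0 := congrFun heq 0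
  have q1 := congrFun heq 1
  simp [ecoField] at q0 q1
  have e0 := congrFun hev 0
  have e1 := congrFun hev 1
  have e2 := congrFun hev 2
  simp only [Matrix.mulVec, dotProduct, Fin.sum_univ_three, Matrix.map_apply, ecoJacobian,
    row0 a1 a2 a3 b1 c1 c2 c3 k1 k2 θ p x5 y5 hD1.ne',
    row1 a1 a2 a3 b1 c1 c2 c3 k1 k2 θ p x5 y5 hD2.ne',
    row2 a1 a2 a3 b1 c1 c2 c3 k1 k2 θ p x5 y5 hD2.ne', Pi.smul_apply, smul_eq_mul] at e0 e1 e2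
  have s01 : (Pi.single 0 1 : Fin 3 → ℝ) 1 = 0 := by simp
  have s02 : (Pi.single 0 1 : Fin 3 → ℝ) 2 = 0 := by simp
  have s10 : (Pi.single 1 1 : Fin 3 → ℝ) 0 = 0 := by simp
  have s12 : (Pi.single 1 1 : Fin 3 → ℝ) 2 = 0 := by simp
  have s20 : (Pi.single 2 1 : Fin 3 → ℝ) 0 = 0 := by simp
  have s21 : (Pi.single 2 1 : Fin 3 → ℝ) 1 = 0 := by simp
  simp only [Pi.single_eq_same, s01, s02, s10, s12, s20, s21, mul_zero, mul_one, sub_zero,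
    add_zero, zero_add, zero_sub, Complex.ofReal_zero, zero_mul] at e0 e1 e2
  by_cases h2 : v 2 = 0
  · rw [h2, mul_zero, add_zero] at e0 e1
    have hne : v 0 ≠ 0 ∨ v 1 ≠ 0 := by
      by_contra hcon
      push Not at hcon
      apply hv
      funext i
      fin_cases i
      · exact hcon.1
      · exact hcon.2
      · exact h2
    refine two_dim_neg ?_ ?_ ?_ ?_ hne e0 e1
    · have ha : a1 = b1 * x5 + c1 * x5 * y5 / (k1 + x5 ^ 2) := by
        apply mul_right_cancel₀ hx5.ne'
        linear_combination q0
      rw [add_comm (x5 ^ 2) k1] at hi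
      have hs : 2 * c1 * x5 * y5 / (k1 + x5 ^ 2) = 2 * (c1 * x5 * y5 / (k1 + x5 ^ 2)) := by ring
      rw [hs]
      linarith
    · have : 0 < c1 * x5 ^ 2 / (k1 + x5 ^ 2) := by positivity
      linarith
    · positivity
    · have ha : a2 = c2 * y5 / (k2 + x5) := by
        apply mul_right_cancel₀ hy5.ne'
        linear_combination q1
      have hs : 2 * c2 * y5 / (k2 + x5) = 2 * (c2 * y5 / (k2 + x5)) := by ring
      rw [hs]
      linarith
  · have hμ := mul_right_cancel₀ h2 e2
    rw [← hμ, Complex.ofReal_re, add_comm k2 x5]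
    linarith
end

section
/- Let (x6, 0, z6) with x6 > 0, z6 > 0 be an equilibrium of system (S) (so z6 = a3·(x6+k2)/c3). Assume (i) b1·x6 + p·c1·x6·z6/(x6²+k1) > 2·p·c1·x6³·z6/(x6²+k1)², and (ii) c2·z6/(x6+k2) + θ·z6 > a2. Then every complex eigenvalue of the Jacobian matrix J(x6, 0, z6) of the vector field F has negative real part. -/
theorem aux_planar (A B C D : ℝ) (hA : A < 0) (hB : B < 0) (hC : 0 < C) (hD : D < 0)
    (μ u w : ℂ) (h : u ≠ 0 ∨ w ≠ 0) (h1 : (A : ℂ) * u + B * w = μ * u)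
    (h2 : (C : ℂ) * u + D * w = μ * w) : μ.re < 0 := by
  have e1 := congrArg Complex.re h1
  have e2 := congrArg Complex.im h1
  have e3 := congrArg Complex.re h2
  have e4 := congrArg Complex.im h2
  simp at e1 e2 e3 e4
  have key : μ.re * (C * (u.re ^ 2 + u.im ^ 2) + (-B) * (w.re ^ 2 + w.im ^ 2))
      = C * A * (u.re ^ 2 + u.im ^ 2) + (-B) * D * (w.re ^ 2 + w.im ^ 2) := by
    linear_combination (-C * u.re) * e1 - C * u.im * e2 + B * w.re * e3 + B * w.im * e4
  have pos : ∀ s : ℂ, s ≠ 0 → 0 < s.re ^ 2 + s.im ^ 2 := by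
    intro s hs
    have := Complex.normSq_pos.2 hs
    rw [Complex.normSq_apply] at this
    nlinarith
  have nu : 0 ≤ u.re ^ 2 + u.im ^ 2 := by positivity
  have nw : 0 ≤ w.re ^ 2 + w.im ^ 2 := by positivity
  have hCA : C * A < 0 := mul_neg_of_pos_of_neg hC hA
  have hBD : (-B) * D < 0 := mul_neg_of_pos_of_neg (by linarith) hD
  by_contra hμ
  push Not at hμ
  have hl : 0 ≤ μ.re * (C * (u.re ^ 2 + u.im ^ 2) + (-B) * (w.re ^ 2 + w.im ^ 2)) := by
    have : 0 ≤ -B := by linarith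
    positivity
  rcases h with h | h
  · have := mul_neg_of_neg_of_pos hCA (pos _ h)
    have := mul_nonpos_of_nonpos_of_nonneg hBD.le nw
    linarith
  · have := mul_neg_of_neg_of_pos hBD (pos _ h)
    have := mul_nonpos_of_nonpos_of_nonneg hCA.le nu
    linarith

theorem aux_line (f : (Fin 3 → ℝ) → ℝ) (pt w : Fin 3 → ℝ) (d : ℝ)
    (hf : DifferentiableAt ℝ f pt) (h : HasDerivAt (fun t : ℝ => f (pt + t • w)) d 0) :
    fderiv ℝ f pt w = d := by
  rw [← hf.lineDeriv_eq_fderiv]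
  exact HasLineDerivAt.lineDeriv h

/-- Local asymptotic stability of the planar equilibrium `E6 = (x6, 0, z6)`:
under conditions (i) and (ii) every complex eigenvalue of the Jacobian at `E6`
has negative real part. -/
theorem E6_eigenvalues_negative_real_part
    (a1 a2 a3 b1 c1 c2 c3 k1 k2 θ p : ℝ)
    (ha1 : 0 < a1) (ha2 : 0 < a2) (ha3 : 0 < a3) (hb1 : 0 < b1)
    (hc1 : 0 < c1) (hc2 : 0 < c2) (hc3 : 0 < c3)
    (hk1 : 0 < k1) (hk2 : 0 < k2) (hθ : 0 < θ) (hp : 0 < p) (hp1 : p ≤ 1)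
    (x6 z6 : ℝ) (hx6 : 0 < x6) (hz6 : 0 < z6)
    (heq : ecoField a1 a2 a3 b1 c1 c2 c3 k1 k2 θ p ![x6, 0, z6] = 0)
    (hi : b1 * x6 + p * c1 * x6 * z6 / (x6 ^ 2 + k1)
        > 2 * p * c1 * x6 ^ 3 * z6 / (x6 ^ 2 + k1) ^ 2)
    (hii : c2 * z6 / (x6 + k2) + θ * z6 > a2) :
    ∀ μ : ℂ,
      (∃ v : Fin 3 → ℂ, v ≠ 0 ∧
        ((ecoJacobian a1 a2 a3 b1 c1 c2 c3 k1 k2 θ p ![x6, 0, z6]).map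
            (fun r : ℝ => (r : ℂ))).mulVec v = μ • v) →
      μ.re < 0 := by
  intro μ ⟨v, hv, hJ⟩
  have hk : k1 + x6 ^ 2 ≠ 0 := by positivity
  have hk' : k2 + x6 ≠ 0 := by positivity
  have d0 : DifferentiableAt ℝ (fun v => ecoField a1 a2 a3 b1 c1 c2 c3 k1 k2 θ p v 0)
      ![x6, 0, z6] := by
    simp only [ecoField, Matrix.cons_val]
    fun_prop (disch := simpa using hk)
  have d1 : DifferentiableAt ℝ (fun v => ecoField a1 a2 a3 b1 c1 c2 c3 k1 k2 θ p v 1)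
      ![x6, 0, z6] := by
    simp only [ecoField, Matrix.cons_val]
    fun_prop (disch := simpa using hk')
  have d2 : DifferentiableAt ℝ (fun v => ecoField a1 a2 a3 b1 c1 c2 c3 k1 k2 θ p v 2)
      ![x6, 0, z6] := by
    simp only [ecoField, Matrix.cons_val]
    fun_prop (disch := simpa using hk')
  have q0 := congrFun heq 0
  have q2 := congrFun heq 2
  simp [ecoField] at q0 q2
  have ea1 : a1 = b1 * x6 + p * c1 * x6 * z6 / (k1 + x6 ^ 2) := by
    apply mul_left_cancel₀ hx6.ne'
    linear_combination q0
  have ea3 : a3 = c3 * z6 / (k2 + x6) := by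
    apply mul_left_cancel₀ hz6.ne'
    linear_combination q2
  have hid : HasDerivAt (fun t : ℝ => t) 1 0 := hasDerivAt_id 0
  have hx : HasDerivAt (fun t : ℝ => x6 + t) 1 0 := hid.const_add x6
  have hz : HasDerivAt (fun t : ℝ => z6 + t) 1 0 := hid.const_add z6
  set J := ecoJacobian a1 a2 a3 b1 c1 c2 c3 k1 k2 θ p ![x6, 0, z6] with hJdef
  have J00 : J 0 0 = -(b1 * x6 + p * c1 * x6 * z6 / (x6 ^ 2 + k1)
        - 2 * p * c1 * x6 ^ 3 * z6 / (x6 ^ 2 + k1) ^ 2) := by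
    refine aux_line _ _ _ _ d0 ?_
    simp [ecoField]
    have := (((hx.const_mul a1).sub ((hx.fun_pow 2).const_mul b1))).sub
      ((((hx.fun_pow 2).const_mul (p * c1)).mul_const z6).fun_div
        ((hx.fun_pow 2).const_add k1) (by simpa using hk))
    refine this.congr_deriv ?_
    simp
    rw [ea1, add_comm (x6 ^ 2) k1]
    field_simp
    ring
  have J02 : J 0 2 = -(p * c1 * x6 ^ 2 / (k1 + x6 ^ 2)) := by
    refine aux_line _ _ _ _ d0 ?_
    simp [ecoField]
    have := ((hz.const_mul (p * c1 * x6 ^ 2)).div_const (k1 + x6 ^ 2)).const_sub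
      (a1 * x6 - b1 * x6 ^ 2)
    refine this.congr_deriv ?_
    simp
  have J10 : J 1 0 = 0 := by
    refine aux_line _ _ _ _ d1 ?_
    simp [ecoField]
    exact hasDerivAt_const _ _
  have J12 : J 1 2 = 0 := by
    refine aux_line _ _ _ _ d1 ?_
    simp [ecoField]
    exact hasDerivAt_const _ _
  have J11 : J 1 1 = a2 - (c2 * z6 / (x6 + k2) + θ * z6) := by
    refine aux_line _ _ _ _ d1 ?_
    simp [ecoField]
    have := ((hid.const_mul a2).sub (((hid.const_mul c2).fun_mul (hid.add_const z6)).div_const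
      (k2 + x6))).sub ((hid.const_mul θ).mul_const z6)
    refine this.congr_deriv ?_
    simp [add_comm x6 k2]
    ring
  have J20 : J 2 0 = c3 * z6 * z6 / (k2 + x6) ^ 2 := by
    refine aux_line _ _ _ _ d2 ?_
    simp [ecoField]
    have := ((hasDerivAt_const (0:ℝ) (c3 * z6 * z6)).fun_div (hx.const_add k2)
      (by simpa using hk')).const_sub (a3 * z6)
    refine this.congr_deriv ?_
    simp
    ring
  have J22 : J 2 2 = -a3 := by
    refine aux_line _ _ _ _ d2 ?_
    simp [ecoField]
    have := (hz.const_mul a3).sub (((hz.const_mul c3).fun_mul hz).div_const (k2 + x6))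
    refine this.congr_deriv ?_
    simp
    rw [ea3]
    field_simp
    ring
  have r0 := congrFun hJ 0
  have r1 := congrFun hJ 1
  have r2 := congrFun hJ 2
  simp only [Matrix.mulVec, dotProduct, Fin.sum_univ_three, Matrix.map_apply, Pi.smul_apply,
    smul_eq_mul, J10, J12, Complex.ofReal_zero, zero_mul, zero_add, add_zero] at r0 r1 r2
  by_cases hv1 : v 1 = 0
  · rw [hv1] at r0 r2
    simp only [mul_zero, add_zero] at r0 r2
    refine aux_planar (J 0 0) (J 0 2) (J 2 0) (J 2 2) ?_ ?_ ?_ ?_ μ (v 0) (v 2) ?_ r0 r2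
    · rw [J00]; linarith
    · rw [J02]
      have : 0 < p * c1 * x6 ^ 2 / (k1 + x6 ^ 2) := by positivity
      linarith
    · rw [J20]; positivity
    · rw [J22]; linarith
    · by_contra hcon
      push Not at hcon
      apply hv
      funext i
      fin_cases i
      · exact hcon.1
      · exact hv1
      · exact hcon.2
  · have hμ := mul_right_cancel₀ hv1 r1
    rw [← hμ, Complex.ofReal_re, J11]
    linarith
end

section
/- Let (x*,y*,z*) with x*, y*, z* > 0 be an equilibrium of system (S) (g1 = g2 = g3 = 0 there). Then for all x, y, z > 0: (x−x*)·g1(x,y,z) + (y−y*)·g2(x,y,z) + (z−z*)·g3(x,y,z) = −[A·(x−x*)² + B·(y−y*)² + C·(z−z*)² + 2H·(x−x*)·(y−y*) + 2F·(y−y*)·(z−z*) + 2G·(x−x*)·(z−z*)], where A = b1 − c1·(y* + p·z*)·(x·x* − k1)/((x*²+k1)·(x²+k1)), B = c2/(x+k2), C = c3/(x+k2), F = (c2+c3)/(2·(x+k2)), H = (1/2)·(c1·x/(x²+k1) − c2·(y*+z*)/((x*+k2)·(x+k2))), G = (1/2)·(p·c1·x/(x²+k1) − c3·(y*+z*)/((x*+k2)·(x+k2))).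 (This is the value of dL/dt along solutions of (S), where L is the Lyapunov function of the global stability theorem.) -/
/-- The derivative of the Lyapunov function along solutions of (S) as a
quadratic form: at an interior equilibrium `(xs, ys, zs)`, for all positive
`(x, y, z)`,
`(x−xs)·g1 + (y−ys)·g2 + (z−zs)·g3 = −[A(x−xs)² + B(y−ys)² + C(z−zs)² + 2H(x−xs)(y−ys) + 2F(y−ys)(z−zs) + 2G(x−xs)(z−zs)]`. -/
theorem lyapunov_derivative_quadratic_form
    (a1 a2 a3 b1 c1 c2 c3 k1 k2 θ p : ℝ)
    (ha1 : 0 < a1) (ha2 : 0 < a2) (ha3 : 0 < a3) (hb1 : 0 < b1)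
    (hc1 : 0 < c1) (hc2 : 0 < c2) (hc3 : 0 < c3)
    (hk1 : 0 < k1) (hk2 : 0 < k2) (hθ : 0 < θ) (hp : 0 < p) (hp1 : p ≤ 1)
    (xs ys zs : ℝ) (hxs : 0 < xs) (hys : 0 < ys) (hzs : 0 < zs)
    (h1 : a1 - b1 * xs - c1 * xs * ys / (xs ^ 2 + k1) - p * c1 * xs * zs / (xs ^ 2 + k1) = 0)
    (h2 : a2 - c2 * (ys + zs) / (xs + k2) - θ * zs = 0)
    (h3 : a3 - c3 * (ys + zs) / (xs + k2) + θ * ys = 0) :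
    ∀ x y z : ℝ, 0 < x → 0 < y → 0 < z →
      (x - xs) * (a1 - b1 * x - c1 * x * y / (x ^ 2 + k1) - p * c1 * x * z / (x ^ 2 + k1))
        + (y - ys) * (a2 - c2 * (y + z) / (x + k2) - θ * z)
        + (z - zs) * (a3 - c3 * (y + z) / (x + k2) + θ * y)
      = -((b1 - c1 * (ys + p * zs) * (x * xs - k1) / ((xs ^ 2 + k1) * (x ^ 2 + k1)))
            * (x - xs) ^ 2
          + (c2 / (x + k2)) * (y - ys) ^ 2
          + (c3 / (x + k2)) * (z - zs) ^ 2
          + 2 * ((1 / 2) * (c1 * x / (x ^ 2 + k1)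
              - c2 * (ys + zs) / ((xs + k2) * (x + k2)))) * (x - xs) * (y - ys)
          + 2 * ((c2 + c3) / (2 * (x + k2))) * (y - ys) * (z - zs)
          + 2 * ((1 / 2) * (p * c1 * x / (x ^ 2 + k1)
              - c3 * (ys + zs) / ((xs + k2) * (x + k2)))) * (x - xs) * (z - zs)) := by
  intro x y z hx hy hz
  have e1 : a1 = b1 * xs + c1 * xs * ys / (xs ^ 2 + k1) + p * c1 * xs * zs / (xs ^ 2 + k1) := by
    linarith
  have e2 : a2 = c2 * (ys + zs) / (xs + k2) + θ * zs := by linarith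
  have e3 : a3 = c3 * (ys + zs) / (xs + k2) - θ * ys := by linarith
  have n1 : xs ^ 2 + k1 ≠ 0 := by positivity
  have n2 : x ^ 2 + k1 ≠ 0 := by positivity
  have n3 : xs + k2 ≠ 0 := by positivity
  have n4 : x + k2 ≠ 0 := by positivity
  clear h1 h2 h3
  rw [e1, e2, e3]
  field_simp
  ring
end

section
/- (Persistence, boundary equilibrium E_3.) Suppose θ·(k2·θ + c2 − c3) ≠ 0 and set y3 = (a2·c3 − a3·c2 − a3·k2·θ)/(θ·(k2·θ + c2 − c3)) and z3 = −(a2·c3 − a3·c2 − a2·k2·θ)/(θ·(k2·θ + c2 − c3)). Then g2(0, y3, z3) = 0 and g3(0, y3, z3) = 0, and consequently Π(0, y3, z3) = γ1·a1 > 0 for all γ1, γ2, γ3 > 0. -/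
/-- Persistence condition at the boundary equilibrium `E3 = (0, y3, z3)`. -/
theorem persistence_at_E3
    (a1 a2 a3 b1 c1 c2 c3 k1 k2 θ p : ℝ)
    (ha1 : 0 < a1) (ha2 : 0 < a2) (ha3 : 0 < a3) (hb1 : 0 < b1)
    (hc1 : 0 < c1) (hc2 : 0 < c2) (hc3 : 0 < c3)
    (hk1 : 0 < k1) (hk2 : 0 < k2) (hθ : 0 < θ) (hp : 0 < p) (hp1 : p ≤ 1)
    (hden : θ * (k2 * θ + c2 - c3) ≠ 0)
    (y3 z3 : ℝ)
    (hy3 : y3 = (a2 * c3 - a3 * c2 - a3 * k2 * θ) / (θ * (k2 * θ + c2 - c3)))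
    (hz3 : z3 = -((a2 * c3 - a3 * c2 - a2 * k2 * θ) / (θ * (k2 * θ + c2 - c3)))) :
    (a2 - c2 * (y3 + z3) / (0 + k2) - θ * z3 = 0) ∧
    (a3 - c3 * (y3 + z3) / (0 + k2) + θ * y3 = 0) ∧
    (∀ γ1 γ2 γ3 : ℝ, 0 < γ1 → 0 < γ2 → 0 < γ3 →
      γ1 * (a1 - b1 * 0 - c1 * 0 * y3 / (0 ^ 2 + k1) - p * c1 * 0 * z3 / (0 ^ 2 + k1))
        + γ2 * (a2 - c2 * (y3 + z3) / (0 + k2) - θ * z3)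
        + γ3 * (a3 - c3 * (y3 + z3) / (0 + k2) + θ * y3)
      = γ1 * a1 ∧ 0 < γ1 * a1) := by
  have hθ0 : θ ≠ 0 := hθ.ne'
  have hk : k2 ≠ 0 := hk2.ne'
  have hD : k2 * θ + c2 - c3 ≠ 0 := right_ne_zero_of_mul hden
  have hs : (y3 + z3) / (0 + k2) = (a2 - a3) / (k2 * θ + c2 - c3) := by
    rw [hy3, hz3, zero_add, div_eq_div_iff hk hD, ← sub_eq_add_neg, ← sub_div,
      div_mul_eq_mul_div, div_eq_iff hden]
    ring
  have hy : θ * y3 = (a2 * c3 - a3 * c2 - a3 * k2 * θ) / (k2 * θ + c2 - c3) := by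
    rw [hy3, ← mul_div_assoc, mul_div_mul_left _ _ hθ0]
  have hz : θ * z3 = -((a2 * c3 - a3 * c2 - a2 * k2 * θ) / (k2 * θ + c2 - c3)) := by
    rw [hz3, mul_neg, ← mul_div_assoc, mul_div_mul_left _ _ hθ0]
  have h2 : a2 - c2 * (y3 + z3) / (0 + k2) - θ * z3 = 0 := by
    rw [mul_div_assoc, hs, hz]
    generalize hd : k2 * θ + c2 - c3 = D at *
    field_simp
    rw [← hd]
    ring
  have h3 : a3 - c3 * (y3 + z3) / (0 + k2) + θ * y3 = 0 := by
    rw [mul_div_assoc, hs, hy]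
    generalize hd : k2 * θ + c2 - c3 = D at *
    field_simp
    rw [← hd]
    ring
  refine ⟨h2, h3, fun γ1 γ2 γ3 h1 _ _ => ⟨?_, mul_pos h1 ha1⟩⟩
  rw [h2, h3]
  simp
end

section
/- (Feasibility of the planar equilibrium E_3.) Suppose c2 > c3 and a3·k2·θ < a2·c3 − a3·c2 < a2·k2·θ. Then the quantities y3 = (a2·c3 − a3·c2 − a3·k2·θ)/(θ·(k2·θ + c2 − c3)) and z3 = −(a2·c3 − a3·c2 − a2·k2·θ)/(θ·(k2·θ + c2 − c3)) satisfy y3 > 0 and z3 > 0, and the point E_3 = (0, y3, z3) is an equilibrium of system (S), i.e. g2(0, y3, z3) = 0 and g3(0, y3, z3) = 0 (and the first equation of (S) vanishes since x = 0). -/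
/-- Feasibility of the planar equilibrium `E3 = (0, y3, z3)`: under the stated
parameter conditions, `y3 > 0`, `z3 > 0`, and `(0, y3, z3)` is an equilibrium
of system (S). -/
theorem feasibility_of_E3
    (a1 a2 a3 b1 c1 c2 c3 k1 k2 θ p : ℝ)
    (ha1 : 0 < a1) (ha2 : 0 < a2) (ha3 : 0 < a3) (hb1 : 0 < b1)
    (hc1 : 0 < c1) (hc2 : 0 < c2) (hc3 : 0 < c3)
    (hk1 : 0 < k1) (hk2 : 0 < k2) (hθ : 0 < θ) (hp : 0 < p) (hp1 : p ≤ 1)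
    (hc23 : c2 > c3)
    (hlow : a3 * k2 * θ < a2 * c3 - a3 * c2)
    (hhigh : a2 * c3 - a3 * c2 < a2 * k2 * θ)
    (y3 z3 : ℝ)
    (hy3 : y3 = (a2 * c3 - a3 * c2 - a3 * k2 * θ) / (θ * (k2 * θ + c2 - c3)))
    (hz3 : z3 = -((a2 * c3 - a3 * c2 - a2 * k2 * θ) / (θ * (k2 * θ + c2 - c3)))) :
    0 < y3 ∧ 0 < z3 ∧
    (a2 - c2 * (y3 + z3) / (0 + k2) - θ * z3 = 0) ∧
    (a3 - c3 * (y3 + z3) / (0 + k2) + θ * y3 = 0) := by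
  have hD : 0 < k2 * θ + c2 - c3 := by
    have := mul_pos hk2 hθ
    linarith
  have hθD := mul_pos hθ hD
  have hDne := hD.ne'
  have hθne := hθ.ne'
  have hkne := hk2.ne'
  have hsum : y3 + z3 = k2 * (a2 - a3) / (k2 * θ + c2 - c3) := by
    rw [hy3, hz3]
    field_simp
    ring
  refine ⟨?_, ?_, ?_, ?_⟩
  · rw [hy3]
    exact div_pos (by linarith) hθD
  · rw [hz3, ← neg_div]
    exact div_pos (by linarith) hθD
  · rw [hsum, hz3, zero_add]
    field_simp
    ring
  · rw [hsum, hy3, zero_add]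
    field_simp
    ring
end
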